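/- arXiv:1701.07137 — 2 statements merged into one kernel-verified Lean document; each statement's English description precedes it below -/
import Mathlib

section
/- Let T be a finite tree with at least three vertices such that for every path (v_0, v_1, …, v_k) between two leaves v_0 and v_k, the sum of the degrees of the interior vertices v_1, …, v_{k−1} is at most M. Then every vertex of T that is not a leaf lies on a path from some leaf to some other leaf as an interior vertex, and has at most M/2 vertices of degree ≥ 2 on the path from it to any fixed leaf; consequently T has at most (M/2)·L non-leaf vertices, where L is the number of leaves. -/
open SimpleGraph Finset

theorem stmt4_extend {V : Type*} [Fintype V] [DecidableEq V] (G : SimpleGraph V)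
    [DecidableRel G.Adj] [Nontrivial V] (hT : G.IsTree) {l : V} (n : ℕ) :
    ∀ (u : V) (p : G.Walk u l), p.IsPath → Fintype.card V ≤ p.length + n →
      ∃ (a : V) (q : G.Walk a l), q.IsPath ∧ G.degree a = 1 ∧ p.support ⊆ q.support := by
  induction n with
  | zero =>
    intro u p hp h
    have := hp.length_lt
    omega
  | succ n ih =>
    intro u p hp h
    by_cases hd : G.degree u = 1
    · exact ⟨u, p, hp, hd, fun _ h => h⟩
    · have hpos : 0 < G.degree u := hT.connected.preconnected.degree_pos_of_nontrivial u
      have h1 : 1 < (G.neighborFinset u).card := by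
        rw [card_neighborFinset_eq_degree]; omega
      obtain ⟨c, hc, hcs⟩ := Finset.exists_mem_ne h1 p.snd
      rw [mem_neighborFinset] at hc
      have hns : c ∉ p.support := fun hs => hcs (hT.isAcyclic.eq_snd_of_adj_start hp hc hs)
      obtain ⟨a, q, hq, ha, hsub⟩ := ih c (Walk.cons hc.symm p) (hp.cons hns)
        (by rw [Walk.length_cons]; omega)
      refine ⟨a, q, hq, ha, fun x hx => hsub ?_⟩
      rw [Walk.support_cons]
      exact List.mem_cons_of_mem _ hx

/-- In a finite tree with at least three vertices in which the interior degree sum of every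
leaf-to-leaf path is at most `M`: every non-leaf vertex is an interior vertex of some
leaf-to-leaf path; every non-leaf vertex has at most `M/2` vertices of degree `≥ 2` on the
path from it to any fixed leaf; consequently the number of non-leaf vertices is at most
`(M/2) · L`, where `L` is the number of leaves. -/
theorem stmt4 {V : Type*} [Fintype V] [DecidableEq V] (G : SimpleGraph V)
    [DecidableRel G.Adj] (hT : G.IsTree) (h3 : 3 ≤ Fintype.card V) (M : ℝ) (hM : 0 < M)
    (hpaths : ∀ ⦃a b : V⦄ (p : G.Walk a b), p.IsPath → G.degree a = 1 → G.degree b = 1 →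
      ∑ v ∈ p.support.toFinset \ {a, b}, (G.degree v : ℝ) ≤ M) :
    (∀ u : V, G.degree u ≠ 1 → ∃ (a b : V) (p : G.Walk a b), p.IsPath ∧
        G.degree a = 1 ∧ G.degree b = 1 ∧ u ∈ p.support ∧ u ≠ a ∧ u ≠ b) ∧
    (∀ u : V, G.degree u ≠ 1 → ∀ ℓ : V, G.degree ℓ = 1 → ∀ p : G.Walk u ℓ, p.IsPath →
        (((p.support.toFinset \ {ℓ}).filter (fun v => 2 ≤ G.degree v)).card : ℝ) ≤ M / 2) ∧
    ((Finset.univ.filter (fun v => G.degree v ≠ 1)).card : ℝ)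
        ≤ (M / 2) * (Finset.univ.filter (fun v => G.degree v = 1)).card := by
  classical
  have : Nontrivial V := Fintype.one_lt_card_iff_nontrivial.mp (by omega)
  have ext := fun (l u : V) (p : G.Walk u l) (hp : p.IsPath) =>
    stmt4_extend G hT (l := l) (Fintype.card V) u p hp (by omega)
  have hpos : ∀ u, 0 < G.degree u := fun u =>
    hT.connected.preconnected.degree_pos_of_nontrivial u
  have key : ∀ (a b : V) (p : G.Walk a b), p.IsPath → G.degree a = 1 → G.degree b = 1 →
      ((p.support.toFinset.filter (fun v => 2 ≤ G.degree v)).card : ℝ) ≤ M / 2 := by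
    intro a b p hp ha hb
    have h := hpaths p hp ha hb
    have hsub : p.support.toFinset.filter (fun v => 2 ≤ G.degree v) ⊆
        p.support.toFinset \ {a, b} := by
      intro v hv
      rw [Finset.mem_filter] at hv
      rw [Finset.mem_sdiff]
      refine ⟨hv.1, fun hm => ?_⟩
      rw [Finset.mem_insert, Finset.mem_singleton] at hm
      rcases hm with rfl | rfl <;> omega
    have h1 := Finset.sum_le_sum_of_subset_of_nonneg (f := fun v => (G.degree v : ℝ)) hsub
      (fun _ _ _ => Nat.cast_nonneg _)
    have h2 := Finset.card_nsmul_le_sum (p.support.toFinset.filter (fun v => 2 ≤ G.degree v))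
      (fun v => (G.degree v : ℝ)) 2
      (fun v hv => by exact_mod_cast (Finset.mem_filter.mp hv).2)
    rw [nsmul_eq_mul] at h2
    linarith
  obtain ⟨l, hl⟩ := hT.exists_vert_degree_one_of_nontrivial
  have thru : ∀ u : V, ∃ (a : V) (q : G.Walk a l), q.IsPath ∧ G.degree a = 1 ∧
      u ∈ q.support := by
    intro u
    obtain ⟨p, hp⟩ := hT.connected.exists_isPath u l
    obtain ⟨a, q, hq, ha, hs⟩ := ext l u p hp
    exact ⟨a, q, hq, ha, hs p.start_mem_support⟩
  refine ⟨?_, ?_, ?_⟩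
  · intro u hu
    obtain ⟨a, q, hq, ha, hs⟩ := thru u
    exact ⟨a, l, q, hq, ha, hl, hs, fun h => hu (h ▸ ha), fun h => hu (h ▸ hl)⟩
  · intro u hu b hb p hp
    obtain ⟨a, q, hq, ha, hs⟩ := ext b u p hp
    refine le_trans ?_ (key a b q hq ha hb)
    have : (p.support.toFinset \ {b}).filter (fun v => 2 ≤ G.degree v) ⊆
        q.support.toFinset.filter (fun v => 2 ≤ G.degree v) := by
      intro v hv
      simp only [Finset.mem_filter, Finset.mem_sdiff, List.mem_toFinset] at hv ⊢
      exact ⟨hs hv.1.1, hv.2⟩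
    exact_mod_cast Finset.card_le_card this
  · choose f hf using fun a : V => hT.connected.exists_isPath a l
    have hsub : Finset.univ.filter (fun v => G.degree v ≠ 1) ⊆
        (Finset.univ.filter (fun v => G.degree v = 1)).biUnion
          (fun a => (f a).support.toFinset.filter (fun v => 2 ≤ G.degree v)) := by
      intro u hu
      have hu1 := (Finset.mem_filter.mp hu).2
      obtain ⟨a, q, hq, ha, hs⟩ := thru u
      have hqf : q = f a := (hT.existsUnique_path a l).unique hq (hf a)
      subst hqf
      have := hpos u
      simp only [Finset.mem_biUnion, Finset.mem_filter, Finset.mem_univ, true_and,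
        List.mem_toFinset]
      exact ⟨a, ha, hs, by omega⟩
    have h1 := (Finset.card_le_card hsub).trans Finset.card_biUnion_le
    have h2 : ((Finset.univ.filter (fun v => G.degree v ≠ 1)).card : ℝ) ≤
        ∑ a ∈ Finset.univ.filter (fun v => G.degree v = 1),
          (((f a).support.toFinset.filter (fun v => 2 ≤ G.degree v)).card : ℝ) := by
      exact_mod_cast h1
    have h3 := Finset.sum_le_card_nsmul (Finset.univ.filter (fun v => G.degree v = 1))
      (fun a => (((f a).support.toFinset.filter (fun v => 2 ≤ G.degree v)).card : ℝ)) (M / 2)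
      (fun a ha => key a l (f a) (hf a) (Finset.mem_filter.mp ha).2 hl)
    rw [nsmul_eq_mul] at h3
    linarith
end

section
/- Let G be a finite graph such that the degree of every circuit of the toric ideal I_G is at most n. Then the degree of every primitive binomial in I_G (every element of the Graver basis of I_G) is at most n²·e^(2n/e). -/
open SimpleGraph MvPolynomial

noncomputable section

/-- The monomial `y_u * y_v` associated to the (potential) edge `{u, v}`. -/
def edgeMono (K : Type*) [Field K] {V : Type*} (e : Sym2 V) : MvPolynomial V K :=
  Sym2.lift ⟨fun a b => MvPolynomial.X a * MvPolynomial.X b,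
    fun a b => mul_comm (MvPolynomial.X a) (MvPolynomial.X b)⟩ e

/-- The toric ideal of the graph `G`: the kernel of the map `K[e : E(G)] → K[y_v : v ∈ V]`
sending the variable of an edge `{u, v}` to `y_u * y_v`. -/
def toricIdeal (K : Type*) [Field K] {V : Type*} (G : SimpleGraph V) :
    Ideal (MvPolynomial G.edgeSet K) :=
  RingHom.ker (MvPolynomial.aeval (R := K)
    (fun e : G.edgeSet => edgeMono K e.1)).toRingHom

/-- The binomial `x^u - x^v`. -/
def binom (K : Type*) [Field K] {σ : Type*} (u v : σ →₀ ℕ) : MvPolynomial σ K :=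
  MvPolynomial.monomial u 1 - MvPolynomial.monomial v 1

/-- `x^u - x^v` is a circuit of `I`: an irreducible binomial of `I` whose support is
minimal among binomials of `I`. -/
def IsCircuitBinom (K : Type*) [Field K] {σ : Type*} [DecidableEq σ]
    (I : Ideal (MvPolynomial σ K)) (u v : σ →₀ ℕ) : Prop :=
  binom K u v ∈ I ∧ u ≠ v ∧ Disjoint u.support v.support ∧
    Irreducible (binom K u v) ∧
    ∀ u' v' : σ →₀ ℕ, u' ≠ v' → binom K u' v' ∈ I →
      u'.support ∪ v'.support ⊆ u.support ∪ v.support →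
      u'.support ∪ v'.support = u.support ∪ v.support

/-- `x^u - x^v` is a primitive binomial of `I` (an element of the Graver basis): no other
binomial `x^{u'} - x^{v'}` of `I` satisfies `x^{u'} ∣ x^u` and `x^{v'} ∣ x^v`. -/
def IsPrimitiveBinom (K : Type*) [Field K] {σ : Type*} [DecidableEq σ]
    (I : Ideal (MvPolynomial σ K)) (u v : σ →₀ ℕ) : Prop :=
  binom K u v ∈ I ∧ u ≠ v ∧ Disjoint u.support v.support ∧
    ∀ u' v' : σ →₀ ℕ, u' ≠ v' → binom K u' v' ∈ I → u' ≤ u → v' ≤ v →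
      u' = u ∧ v' = v

section Combinatorics

variable {V : Type*} [Fintype V] [DecidableEq V]

/-- The vertex-degree map of an integral weighting of pairs. -/
def dg : (Sym2 V → ℤ) →ₗ[ℤ] (V → ℤ) where
  toFun x t := ∑ e, if t ∈ e then x e else 0
  map_add' x y := by
    funext t
    simp only [Pi.add_apply, ← Finset.sum_add_distrib]
    refine Finset.sum_congr rfl fun e _ => ?_
    split_ifs <;> simp
  map_smul' k x := by
    funext t
    simp only [Pi.smul_apply, smul_eq_mul, RingHom.id_apply, Finset.mul_sum]
    refine Finset.sum_congr rfl fun e _ => ?_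
    split_ifs <;> simp

lemma dg_apply (x : Sym2 V → ℤ) (t : V) : dg x t = ∑ e, if t ∈ e then x e else 0 := rfl

lemma dg_single {a b : V} (h : a ≠ b) (v : V) :
    dg (Pi.single s(a, b) 1) v = (if a = v then 1 else 0) + (if b = v then 1 else 0) := by
  rw [dg_apply, Finset.sum_eq_single s(a, b)]
  · simp only [Sym2.mem_iff, Pi.single_eq_same]
    by_cases h1 : a = v
    · subst h1
      simp [h.symm]
    · by_cases h2 : b = v
      · subst h2
        simp [h]
      · simp [h1, h2, Ne.symm h1, Ne.symm h2]
  · intro e _ he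
    simp [Pi.single_apply, he]
  · simp

lemma dg_eq_zero_of_support {x : Sym2 V → ℤ} {S : Set V}
    (hx : ∀ e, x e ≠ 0 → ∀ t ∈ e, t ∈ S) {v : V} (hv : v ∉ S) : dg x v = 0 := by
  rw [dg_apply]
  refine Finset.sum_eq_zero fun e _ => ?_
  split_ifs with h
  · by_contra hne
    exact hv (hx e hne v h)
  · rfl

lemma alt_telescope (f : ℕ → ℤ) (i : ℕ) : ∀ j, i ≤ j →
    ∑ t ∈ Finset.Ico i j, (-1) ^ t * (f t + f (t + 1)) = (-1) ^ i * f i - (-1) ^ j * f j := by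
  intro j hj
  induction j, hj using Nat.le_induction with
  | base => simp
  | succ n hn ih =>
    rw [Finset.sum_Ico_succ_top hn, ih, pow_succ]
    ring

/-- A signed "balloon" (lollipop) at `v` inside `S`. -/
def Balloon (G : SimpleGraph V) (v : V) (S : Set V) (D : ℕ) : Prop :=
  v ∈ S ∧ ∃ x : Sym2 V → ℤ, (∀ e, x e ≠ 0 → e ∈ G.edgeSet ∧ ∀ t ∈ e, t ∈ S) ∧
    dg x = Pi.single v 2 ∧ ∑ e, |x e| = (D : ℤ) ∧
    ∀ y : Sym2 V → ℤ, (∀ e, x e = 0 → y e = 0) → (∀ t, t ≠ v → dg y t = 0) →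
      ∃ k : ℤ, y = k • x

lemma Balloon.mono {G : SimpleGraph V} {v : V} {S T : Set V} {D : ℕ} (h : Balloon G v S D)
    (hST : S ⊆ T) : Balloon G v T D := by
  obtain ⟨hv, x, h1, h2⟩ := h
  exact ⟨hST hv, x, fun e he => ⟨(h1 e he).1, fun t ht => hST ((h1 e he).2 t ht)⟩, h2⟩

lemma Balloon.cons {G : SimpleGraph V} {v v' : V} {S : Set V} {D : ℕ} (h : Balloon G v S D)
    (hadj : G.Adj v' v) (hv' : v' ∉ S) : Balloon G v' (insert v' S) (D + 2) := by
  obtain ⟨hv, x, h1, h2, h3, h4⟩ := h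
  have hne : v' ≠ v := hadj.ne
  have hx0 : x s(v', v) = 0 := by
    by_contra hc
    exact hv' ((h1 _ hc).2 v' (by simp))
  refine ⟨by simp, Pi.single s(v', v) 2 - x, ?_, ?_, ?_, ?_⟩
  · intro e he
    by_cases hee : e = s(v', v)
    · subst hee
      refine ⟨hadj, fun t ht => ?_⟩
      rcases Sym2.mem_iff.1 ht with rfl | rfl
      · simp
      · simp [hv]
    · have : x e ≠ 0 := by
        intro h0
        apply he
        simp [Pi.single_apply, hee, h0]
      exact ⟨(h1 e this).1, fun t ht => Or.inr ((h1 e this).2 t ht)⟩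
  · have : (Pi.single s(v', v) 2 : Sym2 V → ℤ) = (2 : ℤ) • Pi.single s(v', v) 1 := by
      rw [← Pi.single_smul]; simp
    rw [map_sub, this, map_smul, h2]
    funext t
    simp only [Pi.sub_apply, Pi.smul_apply, dg_single hne, Pi.single_apply, smul_eq_mul]
    grind
  · have : ∀ e, |(Pi.single s(v', v) 2 - x : Sym2 V → ℤ) e| = (if e = s(v', v) then 2 else 0) + |x e| := by
      intro e
      by_cases hee : e = s(v', v)
      · subst hee; simp [hx0]
      · simp [hee]
    simp only [this, Finset.sum_add_distrib, h3]
    simp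
    ring
  · intro y hy hy0
    set c := y s(v', v) with hc
    have hsub : ∀ e, x e = 0 → (y - c • Pi.single s(v', v) 1 : Sym2 V → ℤ) e = 0 := by
      intro e he
      by_cases hee : e = s(v', v)
      · subst hee; simp [hc]
      · have := hy e (by simp [hee, he])
        simp [hee, this]
    obtain ⟨k, hk⟩ := h4 _ hsub (by
      intro t ht
      by_cases htv : t = v'
      · subst htv
        refine dg_eq_zero_of_support (S := S) ?_ hv'
        intro e he
        have : x e ≠ 0 := fun h0 => he (hsub e h0)
        exact (h1 e this).2
      · rw [map_sub, map_smul]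
        simp [hy0 t htv, dg_single hne, Ne.symm ht, Ne.symm htv])
    have hv2 : dg (y - c • Pi.single s(v', v) 1) v = k * 2 := by
      rw [hk, map_smul, h2]; simp
    rw [map_sub, map_smul] at hv2
    simp [hy0 v hne.symm, dg_single hne, hne] at hv2
    refine ⟨-k, ?_⟩
    funext e
    have hke := congrFun hk e
    simp only [Pi.sub_apply, Pi.smul_apply, smul_eq_mul, Pi.single_apply] at hke ⊢
    split_ifs at hke ⊢ <;> linarith

/-- A minimal kernel vector. -/
def MinVec (G : SimpleGraph V) (x : Sym2 V → ℤ) : Prop :=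
  (∀ e, x e ≠ 0 → e ∈ G.edgeSet) ∧ dg x = 0 ∧ x ≠ 0 ∧
    ∀ y : Sym2 V → ℤ, (∀ e, x e = 0 → y e = 0) → dg y = 0 → ∃ k : ℤ, y = k • x

lemma Balloon.join {G : SimpleGraph V} {v : V} {S T : Set V} {D D' : ℕ} (h : Balloon G v S D)
    (h' : Balloon G v T D') (hST : ∀ t, t ∈ S → t ∈ T → t = v) :
    ∃ x, MinVec G x ∧ ∑ e, |x e| = (D : ℤ) + D' := by
  obtain ⟨hv, x, h1, h2, h3, h4⟩ := h
  obtain ⟨hv', x', h1', h2', h3', h4'⟩ := h'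
  have hdis : ∀ e, x e = 0 ∨ x' e = 0 := by
    intro e
    by_contra! hc
    obtain ⟨he, hs⟩ := h1 e hc.1
    obtain ⟨-, hs'⟩ := h1' e hc.2
    induction e with
    | _ a b =>
      have ha := hST a (hs a (by simp)) (hs' a (by simp))
      have hb := hST b (hs b (by simp)) (hs' b (by simp))
      exact (G.ne_of_adj he) (ha.trans hb.symm)
  refine ⟨x - x', ⟨?_, ?_, ?_, ?_⟩, ?_⟩
  · intro e he
    by_cases h0 : x e = 0
    · exact (h1' e (by simpa [h0] using he)).1
    · exact (h1 e h0).1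
  · rw [map_sub, h2, h2', sub_self]
  · intro h0
    have hxx : x = x' := sub_eq_zero.1 h0
    have : x = 0 := by
      funext e
      rcases hdis e with h | h
      · simpa using h
      · rw [hxx]; simpa using h
    have h5 := congrFun h2 v
    rw [this] at h5
    simp at h5
  · intro y hy hy0
    set y1 : Sym2 V → ℤ := fun e => if x e = 0 then 0 else y e with hy1
    set y2 : Sym2 V → ℤ := fun e => if x' e = 0 then 0 else y e with hy2
    have hsum : y = y1 + y2 := by
      funext e
      simp only [hy1, hy2, Pi.add_apply]
      by_cases ha : x e = 0
      · by_cases hb : x' e = 0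
        · simp [ha, hb, hy e (by simp [ha, hb])]
        · simp [ha, hb]
      · have hb := (hdis e).resolve_left ha
        simp [ha, hb]
    have hs1 : ∀ e, y1 e ≠ 0 → ∀ t ∈ e, t ∈ S := by
      intro e he
      exact (h1 e (fun h0 => he (by simp [hy1, h0]))).2
    have hs2 : ∀ e, y2 e ≠ 0 → ∀ t ∈ e, t ∈ T := by
      intro e he
      exact (h1' e (fun h0 => he (by simp [hy2, h0]))).2
    have hd : ∀ t, dg y1 t + dg y2 t = 0 := by
      intro t
      rw [← Pi.add_apply, ← map_add, ← hsum, hy0]; rfl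
    have hz : ∀ t, t ≠ v → dg y1 t = 0 ∧ dg y2 t = 0 := by
      intro t ht
      by_cases hS : t ∈ S
      · have := dg_eq_zero_of_support hs2 (fun hT => ht (hST t hS hT))
        have h6 := hd t
        exact ⟨by linarith, this⟩
      · have := dg_eq_zero_of_support hs1 hS
        have h6 := hd t
        exact ⟨this, by linarith⟩
    obtain ⟨k, hk⟩ := h4 y1 (fun e he => by simp [hy1, he]) (fun t ht => (hz t ht).1)
    obtain ⟨k', hk'⟩ := h4' y2 (fun e he => by simp [hy2, he]) (fun t ht => (hz t ht).2)
    have h7 := hd v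
    rw [hk, hk', map_smul, map_smul, h2, h2'] at h7
    simp at h7
    have : k' = -k := by linarith
    refine ⟨k, ?_⟩
    rw [hsum, hk, hk', this, smul_sub, neg_smul, sub_eq_add_neg]
  · rw [← h3, ← h3', ← Finset.sum_add_distrib]
    refine Finset.sum_congr rfl fun e _ => ?_
    rcases hdis e with h | h <;> simp [h]

/-- Cycles carry an alternating vector which is unique up to multiples. -/
lemma cycle_vec {G : SimpleGraph V} (c : ℕ → V) (L : ℕ) (hL : 3 ≤ L)
    (hadj : ∀ t < L, G.Adj (c t) (c (t + 1))) (hc : c 0 = c L)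
    (hinj : ∀ s < L, ∀ t < L, c s = c t → s = t) :
    ∃ x : Sym2 V → ℤ, (∀ e, x e ≠ 0 → ∃ t < L, e = s(c t, c (t + 1))) ∧
      dg x = Pi.single (c 0) (1 - (-1) ^ L) ∧ ∑ e, |x e| = (L : ℤ) ∧
      ∀ y : Sym2 V → ℤ, (∀ e, x e = 0 → y e = 0) → (∀ t, t ≠ c 0 → dg y t = 0) →
        ∃ k : ℤ, y = k • x := by
  set E : ℕ → Sym2 V := fun t => s(c t, c (t + 1)) with hE
  have hEne : ∀ s t, s < t → t < L → E s ≠ E t := by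
    intro s t hst htL heq
    rcases Sym2.eq_iff.1 heq with ⟨h1, -⟩ | ⟨h1, h2⟩
    · have := hinj s (by omega) t htL h1
      omega
    · have h3 := hinj (s + 1) (by omega) t htL h2
      by_cases h4 : t + 1 < L
      · have := hinj s (by omega) (t + 1) h4 h1
        omega
      · have h5 : t + 1 = L := by omega
        rw [h5, ← hc] at h1
        have := hinj s (by omega) 0 (by omega) h1
        omega
  have hEinj : Set.InjOn E (Finset.range L : Set ℕ) := by
    intro s hs t ht hst
    simp at hs ht
    rcases lt_trichotomy s t with h | h | h
    · exact absurd hst (hEne s t h ht)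
    · exact h
    · exact absurd hst.symm (hEne t s h hs)
  set x : Sym2 V → ℤ := ∑ t ∈ Finset.range L, ((-1 : ℤ) ^ t) • Pi.single (E t) 1 with hx
  have hxE : ∀ t < L, x (E t) = (-1) ^ t := by
    intro t ht
    rw [hx, Finset.sum_apply, Finset.sum_eq_single t]
    · simp
    · intro s hs hst
      have : E t ≠ E s := fun h => hst (hEinj hs (by simpa using ht) h.symm)
      simp [this]
    · simp [ht]
  have hx0 : ∀ e, (∀ t < L, e ≠ E t) → x e = 0 := by
    intro e he
    rw [hx, Finset.sum_apply]
    refine Finset.sum_eq_zero fun t ht => ?_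
    simp [he t (by simpa using ht)]
  have hxs : ∀ e, x e ≠ 0 → ∃ t < L, e = E t := by
    intro e he
    by_contra! h
    exact he (hx0 e h)
  have hdE : ∀ t < L, ∀ v, dg (Pi.single (E t) 1) v =
      (if c t = v then 1 else 0) + (if c (t + 1) = v then 1 else 0) := by
    intro t ht v
    exact dg_single (hadj t ht).ne v
  refine ⟨x, hxs, ?_, ?_, ?_⟩
  · funext v
    rw [hx, map_sum, Finset.sum_apply]
    have : ∀ t ∈ Finset.range L, dg ((-1 : ℤ) ^ t • Pi.single (E t) 1 : Sym2 V → ℤ) v =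
        (-1) ^ t * ((fun t => if c t = v then 1 else 0) t +
          (fun t => if c t = v then 1 else 0) (t + 1)) := by
      intro t ht
      rw [map_smul, Pi.smul_apply, hdE t (by simpa using ht), smul_eq_mul]
    rw [Finset.sum_congr rfl this, Finset.range_eq_Ico, alt_telescope _ _ _ (Nat.zero_le L)]
    simp only [← hc, Pi.single_apply]
    by_cases h : c 0 = v
    · simp [h]
    · simp [h, Ne.symm h]
  · rw [← Finset.sum_subset (Finset.subset_univ ((Finset.range L).image E)),
      Finset.sum_image hEinj]
    · rw [Finset.sum_congr rfl (g := fun _ => (1 : ℤ))]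
      · simp
      · intro t ht
        rw [hxE t (by simpa using ht)]
        simp
    · intro e _ he
      rw [hx0 e, abs_zero]
      intro t ht h
      apply he
      rw [h]
      exact Finset.mem_image_of_mem _ (by simpa using ht)
  · intro y hy hy0
    have hys : y = ∑ t ∈ Finset.range L, (y (E t)) • Pi.single (E t) 1 := by
      funext e
      rw [Finset.sum_apply]
      by_cases he : ∃ t < L, e = E t
      · obtain ⟨t, ht, rfl⟩ := he
        rw [Finset.sum_eq_single t]
        · simp
        · intro s hs hst
          have : E t ≠ E s := fun h => hst (hEinj hs (by simpa using ht) h.symm)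
          simp [this]
        · simp [ht]
      · push Not at he
        rw [hy e (hx0 e he)]
        symm
        refine Finset.sum_eq_zero fun t ht => ?_
        simp [he t (by simpa using ht)]
    have hstep : ∀ t, t + 1 < L → y (E t) + y (E (t + 1)) = 0 := by
      intro t ht
      have h0 := hy0 (c (t + 1)) (fun h => by
        have := hinj (t + 1) ht 0 (by omega) h
        omega)
      rw [hys, map_sum, Finset.sum_apply] at h0
      have : ∀ s ∈ Finset.range L, dg (y (E s) • Pi.single (E s) 1 : Sym2 V → ℤ) (c (t + 1)) =
          (if s = t + 1 then y (E s) else 0) + (if s = t then y (E s) else 0) := by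
        intro s hs
        have hs : s < L := by simpa using hs
        rw [map_smul, Pi.smul_apply, hdE s hs, smul_eq_mul, mul_add]
        congr 1
        · by_cases h : s = t + 1
          · simp [h]
          · have : c s ≠ c (t + 1) := fun h' => h (hinj s hs (t + 1) ht h')
            simp [h, this]
        · by_cases h : s = t
          · simp [h]
          · have : c (s + 1) ≠ c (t + 1) := by
              intro h'
              by_cases h4 : s + 1 < L
              · have := hinj (s + 1) h4 (t + 1) ht h'
                omega
              · have h5 : s + 1 = L := by omega
                rw [h5, ← hc] at h'
                have := hinj 0 (by omega) (t + 1) ht h'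
                omega
            simp [h, this]
      rw [Finset.sum_congr rfl this, Finset.sum_add_distrib, Finset.sum_ite_eq',
        Finset.sum_ite_eq', if_pos (by simpa using ht), if_pos (by simp; omega)] at h0
      linarith
    have hall : ∀ t, t < L → y (E t) = (-1) ^ t * y (E 0) := by
      intro t
      induction t with
      | zero => simp
      | succ t ih =>
        intro ht
        have h1 := hstep t ht
        rw [ih (by omega)] at h1
        rw [pow_succ]
        linarith
    refine ⟨y (E 0), ?_⟩
    funext e
    by_cases he : ∃ t < L, e = E t
    · obtain ⟨t, ht, rfl⟩ := he
      rw [Pi.smul_apply, hxE t ht, hall t ht, smul_eq_mul, mul_comm]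
    · push Not at he
      rw [Pi.smul_apply, hx0 e he, hy e (hx0 e he), smul_zero]

/-- The growth function. -/
def FF (D : ℕ) : ℝ := (D : ℝ) * Real.exp ((D : ℝ) / Real.exp 1)

lemma le_exp_div (x : ℝ) : x ≤ Real.exp (x / Real.exp 1) := by
  have h := Real.add_one_le_exp (x / Real.exp 1 - 1)
  have he : 0 < Real.exp 1 := Real.exp_pos 1
  rw [Real.exp_sub, sub_add_cancel, div_le_div_iff_of_pos_right he] at h
  exact h

lemma le_FF (D : ℕ) : (D : ℝ) ≤ FF D := by
  unfold FF
  have : (1 : ℝ) ≤ Real.exp ((D : ℝ) / Real.exp 1) := Real.one_le_exp (by positivity)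
  nlinarith [(Nat.cast_nonneg D : (0 : ℝ) ≤ D)]

lemma FF_mono {a b : ℕ} (h : a ≤ b) : FF a ≤ FF b := by
  unfold FF
  have : (a : ℝ) ≤ b := by exact_mod_cast h
  gcongr

lemma FF_nonneg (D : ℕ) : 0 ≤ FF D := by unfold FF; positivity

lemma FF_step (D t : ℕ) (ht : 1 ≤ t) : (t : ℝ) + (t - 1) * FF D ≤ FF (D + t) := by
  unfold FF
  push_cast
  rw [add_div, Real.exp_add]
  set A := Real.exp ((D : ℝ) / Real.exp 1)
  set B := Real.exp ((t : ℝ) / Real.exp 1)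
  have hA : 1 ≤ A := Real.one_le_exp (by positivity)
  have hB : (t : ℝ) ≤ B := le_exp_div t
  have hD : (0 : ℝ) ≤ D := Nat.cast_nonneg D
  have ht' : (1 : ℝ) ≤ t := by exact_mod_cast ht
  have h1 : ((D : ℝ) + t) * (A * t) ≤ (D + t) * (A * B) := by gcongr
  have h2 : (t : ℝ) ≤ t * (A * t) := by
    have : 1 ≤ A * t := one_le_mul_of_one_le_of_one_le hA ht'
    nlinarith
  have h3 : 0 ≤ (D : ℝ) * A := by positivity
  nlinarith

/-- The structure of a segment of the walk. -/
def QQ (G : SimpleGraph V) (w : ℕ → V) (a b : ℕ) : Prop :=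
  ∃ s : ℕ, (∀ z T D, Balloon G z T D → G.Adj z (w a) → Disjoint T (w '' Set.Icc a b) →
      Balloon G (w b) (T ∪ w '' Set.Icc a b) (D + 2 * (s + 1))) ∧
    ((Set.InjOn w (Set.Icc a b) ∧ s = b - a) ∨
      ∃ p q D, p + q = s ∧ Balloon G (w a) (w '' Set.Icc a b) (D + 2 * p) ∧
        Balloon G (w b) (w '' Set.Icc a b) (D + 2 * q) ∧
        (b : ℝ) - a ≤ s + (s + 1) * FF D)

lemma RR_of_QQ {G : SimpleGraph V} (w : ℕ → V) (N : ℕ)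
    (hadj : ∀ t < N, G.Adj (w t) (w (t + 1)))
    (h2 : ∀ i j, i < j → j ≤ N → w i = w j → Even (j - i) → i = 0 ∧ j = N)
    (i j : ℕ) (hij : i < j) (hj : j ≤ N) (hw : w i = w j) (hne : ¬ (i = 0 ∧ j = N))
    (hQ : i + 1 ≤ j - 1 → QQ G w (i + 1) (j - 1)) :
    ∃ D, Balloon G (w i) (w '' Set.Icc i j) D ∧ (j : ℝ) - i ≤ FF D := by
  have hodd : ¬ Even (j - i) := fun h => hne (h2 i j hij hj hw h)
  have hlen : i + 3 ≤ j := by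
    by_contra! hlt
    have : j = i + 1 := by
      by_contra h
      have : j = i + 2 := by omega
      apply hodd
      rw [this]
      simp
    subst this
    exact (hadj i (by omega)).ne hw
  have hnot : ∀ k, i < k → k < j → w i ≠ w k := by
    intro k hik hkj h
    by_cases he : Even (k - i)
    · have := h2 i k hik (by omega) h he
      omega
    · have : Even (j - k) := by
        have h3 : j - i = (j - k) + (k - i) := by omega
        rw [h3, Nat.even_add] at hodd
        tauto
      have := h2 k j hkj hj (h.symm.trans hw) this
      omega
  have hnotin : w i ∉ w '' Set.Icc (i + 1) (j - 1) := by
    rintro ⟨k, ⟨hk1, hk2⟩, hk⟩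
    exact hnot k (by omega) (by omega) hk.symm
  have hins : insert (w i) (w '' Set.Icc (i + 1) (j - 1)) ⊆ w '' Set.Icc i j := by
    rintro _ (rfl | ⟨k, ⟨hk1, hk2⟩, rfl⟩)
    · exact ⟨i, ⟨le_rfl, by omega⟩, rfl⟩
    · exact ⟨k, ⟨by omega, by omega⟩, rfl⟩
  obtain ⟨s, -, (⟨hinj, -⟩ | ⟨p, q, D, hpq, hb1, hb2, hlen'⟩)⟩ := hQ (by omega)
  · obtain ⟨x, hx1, hx2, hx3, hx4⟩ := cycle_vec (G := G) (fun t => w (i + t)) (j - i) (by omega)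
      (fun t ht => hadj (i + t) (by omega)) (by simp [hw, Nat.add_sub_cancel' hij.le])
      (by
        intro a ha b hb hab
        rcases Nat.eq_zero_or_pos a with rfl | ha0
        · rcases Nat.eq_zero_or_pos b with rfl | hb0
          · rfl
          · exact absurd hab (hnot _ (by omega) (by omega))
        · rcases Nat.eq_zero_or_pos b with rfl | hb0
          · exact absurd hab.symm (hnot _ (by omega) (by omega))
          · have := hinj (x₁ := i + a) ⟨by omega, by omega⟩ (x₂ := i + b) ⟨by omega, by omega⟩ hab
            omega)
    refine ⟨j - i, ⟨⟨i, ⟨le_rfl, hij.le⟩, rfl⟩, x, ?_, ?_, hx3, by simpa using hx4⟩, ?_⟩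
    · intro e he
      obtain ⟨t, ht, rfl⟩ := hx1 e he
      refine ⟨hadj (i + t) (by omega), fun v hv => ?_⟩
      rcases Sym2.mem_iff.1 hv with rfl | rfl
      · exact ⟨i + t, ⟨by omega, by omega⟩, rfl⟩
      · exact ⟨i + (t + 1), ⟨by omega, by omega⟩, rfl⟩
    · rw [hx2, (Nat.not_even_iff_odd.1 hodd).neg_one_pow]
      norm_num
    · refine le_trans ?_ (le_FF _)
      rw [Nat.cast_sub hij.le]
  · have key : (j : ℝ) - i ≤ FF (D + (s + 2)) := by
      refine le_trans ?_ (FF_step D (s + 2) (by omega))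
      push_cast [Nat.cast_sub (show 1 ≤ j by omega)] at hlen' ⊢
      linarith
    rcases le_total p q with h | h
    · refine ⟨D + 2 * q + 2, (hb2.cons ?_ ?_).mono hins, key.trans (FF_mono (by omega))⟩
      · have := hadj (j - 1) (by omega)
        rw [show j - 1 + 1 = j by omega] at this
        rw [hw]
        exact this.symm
      · exact hnotin
    · refine ⟨D + 2 * p + 2, (hb1.cons ?_ ?_).mono hins, key.trans (FF_mono (by omega))⟩
      · exact hadj i (by omega)
      · exact hnotin

lemma QQ_all {G : SimpleGraph V} (w : ℕ → V) (N : ℕ)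
    (hadj : ∀ t < N, G.Adj (w t) (w (t + 1)))
    (h2 : ∀ i j, i < j → j ≤ N → w i = w j → Even (j - i) → i = 0 ∧ j = N)
    (h3 : ∀ i a j b, i < a → a < j → j < b → b ≤ N → w i = w j → w a = w b → False) :
    ∀ d a b, b - a = d → a ≤ b → b < N → QQ G w a b := by
  intro d
  induction d using Nat.strong_induction_on with
  | _ d ih =>
  intro a b hd hab hb
  by_cases hpart : ∃ a', a < a' ∧ a' ≤ b ∧ w a = w a'
  · obtain ⟨a', haa', ha'b, hwa⟩ := hpart
    obtain ⟨D', hB', hF'⟩ := RR_of_QQ w N hadj h2 a a' haa' (by omega) hwa (by omega)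
      (fun h => ih (a' - 1 - (a + 1)) (by omega) _ _ rfl h (by omega))
    by_cases hend : a' = b
    · subst hend
      refine ⟨0, ?_, Or.inr ⟨0, 0, D', rfl, by simpa using hB', by rw [← hwa]; simpa using hB',
        by simpa using hF'⟩⟩
      intro z T D hz hza hT
      rw [← hwa]
      refine (hz.cons hza.symm ?_).mono ?_
      · exact fun h => Set.disjoint_left.1 hT h ⟨a, ⟨le_rfl, hab⟩, rfl⟩
      · rintro _ (rfl | h)
        · exact Or.inr ⟨a, ⟨le_rfl, hab⟩, rfl⟩
        · exact Or.inl h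
    · obtain ⟨s, hext, hor⟩ := ih (b - (a' + 1)) (by omega) (a' + 1) b rfl (by omega) hb
      have hadj' : G.Adj (w a) (w (a' + 1)) := by
        rw [hwa]; exact hadj a' (by omega)
      have hdis : Disjoint (w '' Set.Icc a a') (w '' Set.Icc (a' + 1) b) := by
        rw [Set.disjoint_left]
        rintro _ ⟨k, ⟨hk1, hk2⟩, rfl⟩ ⟨l, ⟨hl1, hl2⟩, hl⟩
        by_cases hka : w k = w a
        · have hla : w a = w l := (hl.trans hka).symm
          have e1 : ¬ Even (a' - a) := fun h => by
            have := h2 a a' haa' (by omega) hwa h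
            omega
          have e2 : ¬ Even (l - a) := fun h => by
            have := h2 a l (by omega) (by omega) hla h
            omega
          have e3 : Even (l - a') := by
            have h4 : l - a = (l - a') + (a' - a) := by omega
            rw [h4, Nat.even_add] at e2
            tauto
          have := h2 a' l (by omega) (by omega) (hwa.symm.trans hla) e3
          omega
        · have hk1' : a ≠ k := fun h => hka (by rw [h])
          have hk2' : k ≠ a' := fun h => hka (by rw [h, hwa])
          exact h3 a k a' l (by omega) (by omega) (by omega) (by omega) hwa hl.symm
      have hsub1 : w '' Set.Icc a a' ⊆ w '' Set.Icc a b :=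
        Set.image_mono (Set.Icc_subset_Icc le_rfl ha'b)
      have hsub2 : w '' Set.Icc (a' + 1) b ⊆ w '' Set.Icc a b :=
        Set.image_mono (Set.Icc_subset_Icc (by omega) le_rfl)
      have hains : w a ∈ w '' Set.Icc a a' := ⟨a, ⟨le_rfl, haa'.le⟩, rfl⟩
      have hwanot : w a ∉ w '' Set.Icc (a' + 1) b := Set.disjoint_left.1 hdis hains
      refine ⟨s + 1, ?_, Or.inr ?_⟩
      · intro z T D hz hza hT
        have hzT : w a ∉ T := fun h => Set.disjoint_left.1 hT h (hsub1 hains)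
        have hz' := hz.cons hza.symm hzT
        have := hext _ _ _ hz' hadj' (by
          rw [Set.disjoint_left]
          rintro v (rfl | hv) hv2
          · exact hwanot hv2
          · exact Set.disjoint_left.1 hT hv (hsub2 hv2))
        have h5 := this.mono (T := T ∪ w '' Set.Icc a b) (by
          rintro v ((rfl | hv) | hv)
          · exact Or.inr (hsub1 hains)
          · exact Or.inl hv
          · exact Or.inr (hsub2 hv))
        have h6 : D + 2 + 2 * (s + 1) = D + 2 * (s + 1 + 1) := by ring
        rwa [h6] at h5
      · have hBb := (hext _ _ _ hB' hadj' hdis).mono (T := w '' Set.Icc a b)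
          (Set.union_subset hsub1 hsub2)
        rcases hor with ⟨-, hs⟩ | ⟨p, q, D, hpq, hb1, hb2, hlen⟩
        · refine ⟨0, s + 1, D', by omega, by simpa using hB'.mono hsub1, hBb, ?_⟩
          have h7 : b = a' + 1 + s := by omega
          rw [h7]
          push_cast
          have h8 := FF_nonneg D'
          have h9 : (0 : ℝ) ≤ s := Nat.cast_nonneg s
          nlinarith
        · rcases le_total D' D with hDD | hDD
          · refine ⟨p + 1, q, D, by omega, ?_, hb2.mono hsub2, ?_⟩
            · have := (hb1.cons hadj' hwanot).mono (T := w '' Set.Icc a b) (by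
                rintro v (rfl | hv)
                · exact hsub1 hains
                · exact hsub2 hv)
              exact this
            · have h7 := FF_mono hDD
              push_cast at hlen ⊢
              linarith
          · refine ⟨0, s + 1, D', by omega, by simpa using hB'.mono hsub1, hBb, ?_⟩
            have h7 := FF_mono hDD
            have h9 : (0 : ℝ) ≤ s := Nat.cast_nonneg s
            have h10 : ((s : ℝ) + 1) * FF D ≤ (s + 1) * FF D' := by gcongr
            push_cast at hlen ⊢
            linarith
  · push Not at hpart
    by_cases hend : a = b
    · subst hend
      refine ⟨0, ?_, Or.inl ⟨by simp, by simp⟩⟩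
      intro z T D hz hza hT
      refine (hz.cons hza.symm ?_).mono ?_
      · exact fun h => Set.disjoint_left.1 hT h ⟨a, ⟨le_rfl, le_rfl⟩, rfl⟩
      · rintro _ (rfl | h)
        · exact Or.inr ⟨a, ⟨le_rfl, le_rfl⟩, rfl⟩
        · exact Or.inl h
    · obtain ⟨s, hext, hor⟩ := ih (b - (a + 1)) (by omega) (a + 1) b rfl (by omega) hb
      have hadj' : G.Adj (w a) (w (a + 1)) := hadj a (by omega)
      have hsub2 : w '' Set.Icc (a + 1) b ⊆ w '' Set.Icc a b :=
        Set.image_mono (Set.Icc_subset_Icc (by omega) le_rfl)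
      have hains : w a ∈ w '' Set.Icc a b := ⟨a, ⟨le_rfl, hab⟩, rfl⟩
      have hwanot : w a ∉ w '' Set.Icc (a + 1) b := by
        rintro ⟨k, ⟨hk1, hk2⟩, hk⟩
        exact hpart k (by omega) hk2 hk.symm
      refine ⟨s + 1, ?_, ?_⟩
      · intro z T D hz hza hT
        have hzT : w a ∉ T := fun h => Set.disjoint_left.1 hT h hains
        have hz' := hz.cons hza.symm hzT
        have := hext _ _ _ hz' hadj' (by
          rw [Set.disjoint_left]
          rintro v (rfl | hv) hv2
          · exact hwanot hv2
          · exact Set.disjoint_left.1 hT hv (hsub2 hv2))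
        have h5 := this.mono (T := T ∪ w '' Set.Icc a b) (by
          rintro v ((rfl | hv) | hv)
          · exact Or.inr hains
          · exact Or.inl hv
          · exact Or.inr (hsub2 hv))
        have h6 : D + 2 + 2 * (s + 1) = D + 2 * (s + 1 + 1) := by ring
        rwa [h6] at h5
      · rcases hor with ⟨hinj, hs⟩ | ⟨p, q, D, hpq, hb1, hb2, hlen⟩
        · refine Or.inl ⟨?_, by omega⟩
          intro k hk l hl hkl
          obtain ⟨hk1, hk2⟩ := hk
          obtain ⟨hl1, hl2⟩ := hl
          rcases hk1.eq_or_lt with rfl | hk1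
          · rcases hl1.eq_or_lt with rfl | hl1
            · rfl
            · exact absurd hkl (hpart l hl1 hl2)
          · rcases hl1.eq_or_lt with rfl | hl1
            · exact absurd hkl.symm (hpart k hk1 hk2)
            · exact hinj ⟨hk1, hk2⟩ ⟨hl1, hl2⟩ hkl
        · refine Or.inr ⟨p + 1, q, D, by omega, ?_, hb2.mono hsub2, ?_⟩
          · exact (hb1.cons hadj' hwanot).mono (by
              rintro v (rfl | hv)
              · exact hains
              · exact hsub2 hv)
          · have h7 := FF_nonneg D
            push_cast at hlen ⊢
            linarith

/-- The bound for a closed walk returning to its start. -/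
lemma walk_bound {G : SimpleGraph V} (w : ℕ → V) (N n : ℕ)
    (hn : ∀ x, MinVec G x → ∑ e, |x e| ≤ 2 * (n : ℤ))
    (hadj : ∀ t < N, G.Adj (w t) (w (t + 1)))
    (h2 : ∀ i j, i < j → j ≤ N → w i = w j → Even (j - i) → i = 0 ∧ j = N)
    (h3 : ∀ i a j b, i < a → a < j → j < b → b ≤ N → w i = w j → w a = w b → False)
    (hclosed : w 0 = w N) (j : ℕ) (hj0 : 0 < j) (hjN : j < N) (hj : w 0 = w j) :
    (N : ℝ) ≤ 2 * n * Real.exp (2 * n / Real.exp 1) := by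
  have hQ := QQ_all w N hadj h2 h3
  obtain ⟨D1, hB1, hF1⟩ := RR_of_QQ w N hadj h2 0 j hj0 hjN.le hj (by omega)
    (fun h => hQ _ _ _ rfl h (by omega))
  obtain ⟨D2, hB2, hF2⟩ := RR_of_QQ w N hadj h2 j N hjN le_rfl (hj.symm.trans hclosed) (by omega)
    (fun h => hQ _ _ _ rfl h (by omega))
  rw [← hj] at hB2
  obtain ⟨x, hx, hxs⟩ := hB1.join hB2 (by
    rintro _ ⟨k, ⟨hk1, hk2⟩, rfl⟩ ⟨l, ⟨hl1, hl2⟩, hl⟩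
    by_contra hne
    have a1 : k ≠ 0 := fun h => hne (by rw [h])
    have a2 : k ≠ j := fun h => hne (by rw [h, hj])
    have a3 : l ≠ j := fun h => hne (by rw [← hl, h, hj])
    exact h3 0 k j l (by omega) (by omega) (by omega) hl2 hj hl.symm)
  have hle := hn x hx
  rw [hxs] at hle
  have hle' : D1 + D2 ≤ 2 * n := by exact_mod_cast hle
  have hleR : (D1 : ℝ) + D2 ≤ 2 * n := by exact_mod_cast hle'
  set E := Real.exp (2 * n / Real.exp 1)
  have key : ∀ D : ℕ, D ≤ 2 * n → FF D ≤ D * E := by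
    intro D hD
    unfold FF
    have : (D : ℝ) ≤ 2 * n := by exact_mod_cast hD
    have h9 : Real.exp ((D : ℝ) / Real.exp 1) ≤ E := by
      apply Real.exp_le_exp.2
      gcongr
    gcongr
  have k1 := key D1 (by omega)
  have k2 := key D2 (by omega)
  have hE : 0 < E := Real.exp_pos _
  push_cast at hF1
  nlinarith

lemma dg_mono {x y : Sym2 V → ℤ} (h : x ≤ y) (t : V) : dg x t ≤ dg y t := by
  rw [dg_apply, dg_apply]
  refine Finset.sum_le_sum fun e _ => ?_
  split_ifs
  · exact h e
  · exact le_rfl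

lemma sum_dg {G : SimpleGraph V} {x : Sym2 V → ℤ} (hx : ∀ e, x e ≠ 0 → e ∈ G.edgeSet) :
    ∑ t, dg x t = 2 * ∑ e, x e := by
  simp only [dg_apply]
  rw [Finset.sum_comm, Finset.mul_sum]
  refine Finset.sum_congr rfl fun e _ => ?_
  by_cases h : x e = 0
  · simp [h]
  · have he := hx e h
    induction e with
    | _ a b =>
      have hab : a ≠ b := G.ne_of_adj he
      rw [← Finset.sum_filter, Finset.sum_const]
      have : Finset.univ.filter (fun t => t ∈ s(a, b)) = {a, b} := by
        ext t; simp
      rw [this, Finset.card_pair hab]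
      simp

/-- Indicator sum of the edges of the walk at the times in `S` of residue `r`. -/
def TU (w : ℕ → V) (r : ℕ) (S : Finset ℕ) : Sym2 V → ℤ :=
  ∑ t ∈ S, if t % 2 = r then Pi.single s(w t, w (t + 1)) 1 else 0

lemma TU_nonneg (w : ℕ → V) (r : ℕ) (S : Finset ℕ) : 0 ≤ TU w r S := by
  refine Finset.sum_nonneg fun t _ => ?_
  split_ifs
  · exact Pi.single_nonneg.2 zero_le_one
  · exact le_rfl

lemma TU_mono (w : ℕ → V) (r : ℕ) {S T : Finset ℕ} (h : S ⊆ T) : TU w r S ≤ TU w r T := by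
  refine Finset.sum_le_sum_of_subset_of_nonneg h fun t _ _ => ?_
  split_ifs
  · exact Pi.single_nonneg.2 zero_le_one
  · exact le_rfl

lemma TU_card (w : ℕ → V) (S : Finset ℕ) :
    ∑ e, TU w 0 S e + ∑ e, TU w 1 S e = (S.card : ℤ) := by
  simp only [TU, Finset.sum_apply]
  rw [Finset.sum_comm, Finset.sum_comm (s := Finset.univ), ← Finset.sum_add_distrib,
    Finset.card_eq_sum_ones, Nat.cast_sum]
  refine Finset.sum_congr rfl fun t _ => ?_
  rcases Nat.mod_two_eq_zero_or_one t with h | h <;> simp [h]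

lemma dg_TU {G : SimpleGraph V} (w : ℕ → V) (r : ℕ) (S : Finset ℕ)
    (h : ∀ t ∈ S, G.Adj (w t) (w (t + 1))) (x : V) :
    dg (TU w r S) x = ∑ t ∈ S, if t % 2 = r then
      ((if w t = x then 1 else 0) + (if w (t + 1) = x then 1 else 0)) else 0 := by
  rw [TU, map_sum, Finset.sum_apply]
  refine Finset.sum_congr rfl fun t ht => ?_
  split_ifs with h1
  all_goals first
    | (rw [dg_single (h t ht).ne]; simp [*])
    | simp

lemma dg_TU_sub {G : SimpleGraph V} (w : ℕ → V) (S : Finset ℕ)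
    (h : ∀ t ∈ S, G.Adj (w t) (w (t + 1))) (x : V) :
    dg (TU w 0 S) x - dg (TU w 1 S) x = ∑ t ∈ S, (-1) ^ t *
      ((fun t => if w t = x then 1 else 0) t + (fun t => if w t = x then 1 else 0) (t + 1)) := by
  rw [dg_TU w 0 S h, dg_TU w 1 S h, ← Finset.sum_sub_distrib]
  refine Finset.sum_congr rfl fun t _ => ?_
  rcases Nat.mod_two_eq_zero_or_one t with h | h
  · rw [(Nat.even_iff.2 h).neg_one_pow]; simp [h]
  · rw [(Nat.odd_iff.2 h).neg_one_pow]; simp [h]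

lemma dg_TU_add {G : SimpleGraph V} (w : ℕ → V) (S : Finset ℕ)
    (h : ∀ t ∈ S, G.Adj (w t) (w (t + 1))) (x : V) :
    dg (TU w 0 S) x + dg (TU w 1 S) x = ∑ t ∈ S,
      ((if w t = x then 1 else 0) + (if w (t + 1) = x then 1 else 0)) := by
  rw [dg_TU w 0 S h, dg_TU w 1 S h, ← Finset.sum_add_distrib]
  refine Finset.sum_congr rfl fun t _ => ?_
  rcases Nat.mod_two_eq_zero_or_one t with h | h <;> simp [h]

/-- The combinatorial form of a primitive pair. -/
structure PrimPair (G : SimpleGraph V) (u v : Sym2 V → ℤ) : Prop where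
  hu0 : 0 ≤ u
  hv0 : 0 ≤ v
  hue : ∀ e, u e ≠ 0 → e ∈ G.edgeSet
  hve : ∀ e, v e ≠ 0 → e ∈ G.edgeSet
  hdeg : dg u = dg v
  hdisj : ∀ e, u e = 0 ∨ v e = 0
  hne : u ≠ 0
  hprim : ∀ u' v' : Sym2 V → ℤ, 0 ≤ u' → 0 ≤ v' → u' ≤ u → v' ≤ v → dg u' = dg v' →
    (u' ≠ 0 ∨ v' ≠ 0) → u' = u ∧ v' = v

/-- Alternating trails using edges within the multiplicities. -/
def Trail (G : SimpleGraph V) (u v : Sym2 V → ℤ) (w : ℕ → V) (k : ℕ) : Prop :=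
  (∀ t < k, G.Adj (w t) (w (t + 1))) ∧ TU w 0 (Finset.range k) ≤ u ∧ TU w 1 (Finset.range k) ≤ v

lemma Trail.le {G : SimpleGraph V} {u v : Sym2 V → ℤ} {w : ℕ → V} {k : ℕ} (h : Trail G u v w k) :
    (k : ℤ) ≤ ∑ e, u e + ∑ e, v e := by
  have := TU_card w (Finset.range k)
  rw [Finset.card_range] at this
  rw [← this]
  exact add_le_add (Finset.sum_le_sum fun e _ => h.2.1 e) (Finset.sum_le_sum fun e _ => h.2.2 e)

lemma TU_update (w : ℕ → V) (r k : ℕ) (z : V) :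
    TU (Function.update w (k + 1) z) r (Finset.range (k + 1)) =
      TU w r (Finset.range k) + if k % 2 = r then Pi.single s(w k, z) 1 else 0 := by
  rw [TU, Finset.sum_range_succ, TU]
  congr 1
  · refine Finset.sum_congr rfl fun t ht => ?_
    have : t < k := by simpa using ht
    rw [Function.update_of_ne (by omega), Function.update_of_ne (by omega)]
  · rw [Function.update_of_ne (by omega), Function.update_self]

lemma exists_step {a b : Sym2 V → ℤ} {y : V} (h : dg a y < dg b y) :
    ∃ z, a s(y, z) < b s(y, z) := by
  rw [dg_apply, dg_apply] at h
  obtain ⟨e, -, he⟩ := Finset.exists_lt_of_sum_lt h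
  split_ifs at he with hy
  · obtain ⟨z, rfl⟩ := hy
    exact ⟨z, he⟩
  · exact absurd he (lt_irrefl _)

lemma add_single_le {a b : Sym2 V → ℤ} (h : a ≤ b) {e : Sym2 V} (he : a e < b e) :
    a + Pi.single e 1 ≤ b := by
  intro f
  by_cases hf : f = e
  · subst hf; simp; omega
  · simpa [hf] using h f

lemma exists_closed {G : SimpleGraph V} {u v : Sym2 V → ℤ} (hp : PrimPair G u v) (x : V)
    (hx : 0 < dg u x) :
    ∃ w k, Trail G u v w k ∧ 0 < k ∧ Even k ∧ w 0 = x ∧ w k = x := by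
  by_contra hno
  push Not at hno
  have hall : ∀ k, ∃ w, Trail G u v w k ∧ w 0 = x := by
    intro k
    induction k with
    | zero =>
      refine ⟨fun _ => x, ⟨by simp, ?_, ?_⟩, rfl⟩
      · simpa [TU] using hp.hu0
      · simpa [TU] using hp.hv0
    | succ k ih =>
      obtain ⟨w, hw, hw0⟩ := ih
      have hsub := dg_TU_sub w (Finset.range k) (fun t ht => hw.1 t (by simpa using ht)) (w k)
      rw [Finset.range_eq_Ico, alt_telescope _ _ _ (Nat.zero_le k), ← Finset.range_eq_Ico] at hsub
      have hm0 := dg_mono hw.2.1 (w k)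
      have hm1 := dg_mono hw.2.2 (w k)
      have hd := congrFun hp.hdeg (w k)
      rcases Nat.mod_two_eq_zero_or_one k with hk | hk
      · have hlt : dg (TU w 0 (Finset.range k)) (w k) < dg u (w k) := by
          rcases Nat.eq_zero_or_pos k with rfl | hkpos
          · simp [TU, hw0, hx]
          · have hne := hno w k hw hkpos (Nat.even_iff.2 hk) hw0
            rw [(Nat.even_iff.2 hk).neg_one_pow] at hsub
            simp [hw0, Ne.symm hne] at hsub
            linarith
        obtain ⟨z, hz⟩ := exists_step hlt
        have hzadj : G.Adj (w k) z := by
          have h0 := TU_nonneg w 0 (Finset.range k) s(w k, z)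
          simp only [Pi.zero_apply] at h0
          exact hp.hue s(w k, z) (by omega)
        refine ⟨Function.update w (k + 1) z, ⟨?_, ?_, ?_⟩, ?_⟩
        · intro t ht
          rcases Nat.lt_succ_iff_lt_or_eq.1 ht with h | rfl
          · rw [Function.update_of_ne (by omega), Function.update_of_ne (by omega)]
            exact hw.1 t h
          · rw [Function.update_of_ne (by omega), Function.update_self]
            exact hzadj
        · rw [TU_update, if_pos hk]
          exact add_single_le hw.2.1 hz
        · rw [TU_update, if_neg (by omega), add_zero]
          exact hw.2.2
        · rw [Function.update_of_ne (by omega), hw0]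
      · have hlt : dg (TU w 1 (Finset.range k)) (w k) < dg v (w k) := by
          rw [(Nat.odd_iff.2 hk).neg_one_pow] at hsub
          simp at hsub
          split_ifs at hsub <;> linarith
        obtain ⟨z, hz⟩ := exists_step hlt
        have hzadj : G.Adj (w k) z := by
          have h0 := TU_nonneg w 1 (Finset.range k) s(w k, z)
          simp only [Pi.zero_apply] at h0
          exact hp.hve s(w k, z) (by omega)
        refine ⟨Function.update w (k + 1) z, ⟨?_, ?_, ?_⟩, ?_⟩
        · intro t ht
          rcases Nat.lt_succ_iff_lt_or_eq.1 ht with h | rfl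
          · rw [Function.update_of_ne (by omega), Function.update_of_ne (by omega)]
            exact hw.1 t h
          · rw [Function.update_of_ne (by omega), Function.update_self]
            exact hzadj
        · rw [TU_update, if_neg (by omega), add_zero]
          exact hw.2.1
        · rw [TU_update, if_pos hk]
          exact add_single_le hw.2.2 hz
        · rw [Function.update_of_ne (by omega), hw0]
  obtain ⟨w, hw, -⟩ := hall ((∑ e, u e + ∑ e, v e).toNat + 1)
  have := hw.le
  push_cast at this
  omega

/-- Balanced sets of times are everything. -/
lemma balanced {G : SimpleGraph V} {u v : Sym2 V → ℤ} (hp : PrimPair G u v) {w : ℕ → V} {k : ℕ}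
    (hw : Trail G u v w k) (S : Finset ℕ) (hS : S ⊆ Finset.range k) (hne : S.Nonempty)
    (hbal : ∀ x, ∑ t ∈ S, (-1) ^ t * ((fun t => if w t = x then (1 : ℤ) else 0) t +
      (fun t => if w t = x then 1 else 0) (t + 1)) = 0) :
    S = Finset.range k ∧ TU w 0 S = u ∧ TU w 1 S = v := by
  have hadj : ∀ t ∈ S, G.Adj (w t) (w (t + 1)) := fun t ht => hw.1 t (by simpa using hS ht)
  have hc := TU_card w S
  have hprim := hp.hprim (TU w 0 S) (TU w 1 S) (TU_nonneg _ _ _) (TU_nonneg _ _ _)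
    ((TU_mono w 0 hS).trans hw.2.1) ((TU_mono w 1 hS).trans hw.2.2) (by
      funext x
      have := dg_TU_sub w S hadj x
      rw [hbal x] at this
      linarith) (by
      by_contra! h
      rw [h.1, h.2] at hc
      simp at hc
      have hc' : S.card = 0 := by exact_mod_cast hc.symm
      exact hne.ne_empty (Finset.card_eq_zero.1 hc'))
  refine ⟨?_, hprim⟩
  rw [hprim.1, hprim.2] at hc
  refine Finset.eq_of_subset_of_card_le hS ?_
  have := hw.le
  rw [hc] at this
  simpa using this

/-- The combinatorial theorem. -/
lemma comb_main {G : SimpleGraph V} {u v : Sym2 V → ℤ} (hp : PrimPair G u v) (n : ℕ)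
    (hn : ∀ x, MinVec G x → ∑ e, |x e| ≤ 2 * (n : ℤ)) :
    ((∑ e, u e : ℤ) : ℝ) ≤ (n : ℝ) ^ 2 * Real.exp (2 * n / Real.exp 1) := by
  have huv : ∑ e, u e = ∑ e, v e := by
    have h1 := sum_dg hp.hue
    have h2 := sum_dg hp.hve
    rw [hp.hdeg] at h1
    linarith
  have hE1 : (1 : ℝ) ≤ Real.exp (2 * n / Real.exp 1) := Real.one_le_exp (by positivity)
  have hnn : (n : ℝ) ≤ (n : ℝ) ^ 2 := by
    exact_mod_cast Nat.le_self_pow (by norm_num) n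
  -- facts about closed trails
  have hfull : ∀ w k, Trail G u v w k → 0 < k → Even k → w 0 = w k →
      TU w 0 (Finset.range k) = u ∧ TU w 1 (Finset.range k) = v ∧
      (k : ℤ) = 2 * ∑ e, u e ∧
      ∀ x, dg u x = ∑ t ∈ Finset.range k, if w t = x then 1 else 0 := by
    intro w k hw hk hke hcl
    obtain ⟨-, h1, h2⟩ := balanced hp hw (Finset.range k) subset_rfl (by simpa using hk.ne') (by
      intro x
      rw [Finset.range_eq_Ico, alt_telescope _ _ _ (Nat.zero_le k), hke.neg_one_pow]
      simp [hcl])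
    refine ⟨h1, h2, ?_, ?_⟩
    · have := TU_card w (Finset.range k)
      rw [h1, h2, Finset.card_range] at this
      linarith
    · intro x
      have h3 := dg_TU_add w (Finset.range k) (fun t ht => hw.1 t (by simpa using ht)) x
      rw [h1, h2, ← hp.hdeg, Finset.sum_add_distrib] at h3
      have h4 := Finset.sum_range_succ (fun t => if w t = x then (1 : ℤ) else 0) k
      have h5 := Finset.sum_range_succ' (fun t => if w t = x then (1 : ℤ) else 0) k
      rw [h4, hcl] at h5
      linarith
  by_cases hbig : ∃ x, 2 ≤ dg u x
  · obtain ⟨x, hx⟩ := hbig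
    obtain ⟨w, k, hw, hk, hke, hw0, hwk⟩ := exists_closed hp x (by linarith)
    have hcl : w 0 = w k := hw0.trans hwk.symm
    obtain ⟨-, -, hkU, hvis⟩ := hfull w k hw hk hke hcl
    have h2 : ∀ i j, i < j → j ≤ k → w i = w j → Even (j - i) → i = 0 ∧ j = k := by
      intro i j hij hjk hwij hev
      have hS := (balanced hp hw (Finset.Ico i j) (by
        intro t ht
        simp at ht ⊢
        omega) (by simpa using hij) (by
        intro x
        rw [alt_telescope _ _ _ hij.le]
        have : ((-1 : ℤ)) ^ j = (-1) ^ i := by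
          rw [show j = i + (j - i) by omega, pow_add, hev.neg_one_pow, mul_one]
        simp [this, hwij])).1
      have hc := congrArg Finset.card hS
      simp at hc
      omega
    have hopp : ∀ i j, i < j → j ≤ k → w i = w j → ¬ (i = 0 ∧ j = k) →
        (-1 : ℤ) ^ j = - (-1) ^ i := by
      intro i j hij hjk hwij hne
      have hodd : Odd (j - i) := Nat.not_even_iff_odd.1 fun h => hne (h2 i j hij hjk hwij h)
      rw [show j = i + (j - i) by omega, pow_add, hodd.neg_one_pow]
      ring
    have h3 : ∀ i a j b, i < a → a < j → j < b → b ≤ k → w i = w j → w a = w b → False := by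
      intro i a j b hia haj hjb hbk hwij hwab
      have hS := (balanced hp hw (Finset.Ico i a ∪ Finset.Ico j b) (by
        intro t ht
        simp at ht ⊢
        omega) ⟨i, by simp [hia]⟩ (by
        intro x
        rw [Finset.sum_union, alt_telescope _ _ _ hia.le, alt_telescope _ _ _ hjb.le,
          hopp i j (by omega) (by omega) hwij (by omega),
          hopp a b (by omega) (by omega) hwab (by omega)]
        · simp only [hwij, hwab]
          ring
        · rw [Finset.disjoint_left]
          intro t ht ht'
          simp at ht ht'
          omega)).1
      have : a ∈ Finset.Ico i a ∪ Finset.Ico j b := by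
        rw [hS]
        simp
        omega
      simp at this
      omega
    have hexj : ∃ j, 0 < j ∧ j < k ∧ w 0 = w j := by
      by_contra! hnoj
      have h4 := hvis x
      rw [Finset.sum_eq_single 0] at h4
      · rw [if_pos hw0] at h4
        linarith
      · intro t ht ht0
        have := hnoj t (by omega) (by simpa using ht)
        rw [if_neg]
        intro h
        exact this (hw0.trans h.symm)
      · intro h
        simp at h
        omega
    obtain ⟨j, hj0, hjk, hj⟩ := hexj
    have hb := walk_bound w k n hn hw.1 h2 h3 hcl j hj0 hjk hj
    have hkR : (k : ℝ) = 2 * ((∑ e, u e : ℤ) : ℝ) := by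
      exact_mod_cast congrArg (fun z : ℤ => (z : ℝ)) hkU
    nlinarith
  · push Not at hbig
    obtain ⟨e, he⟩ : ∃ e, u e ≠ 0 := by
      by_contra! h
      exact hp.hne (funext h)
    obtain ⟨x, hx⟩ : ∃ x, 0 < dg u x := by
      induction e with
      | _ a b =>
        refine ⟨a, ?_⟩
        rw [dg_apply]
        refine Finset.sum_pos' ?_ ⟨s(a, b), Finset.mem_univ _, ?_⟩
        · intro f _
          split_ifs
          · exact hp.hu0 f
          · exact le_rfl
        · simp only [Sym2.mem_iff, true_or, if_true]
          exact lt_of_le_of_ne (hp.hu0 _) (Ne.symm he)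
    obtain ⟨w, k, hw, hk, hke, hw0, hwk⟩ := exists_closed hp x hx
    have hcl : w 0 = w k := hw0.trans hwk.symm
    obtain ⟨hTu, hTv, hkU, hvis⟩ := hfull w k hw hk hke hcl
    have hlt : ∀ s t, s < t → t < k → w s ≠ w t := by
      intro s t hst htk heq
      have h4 := hvis (w s)
      have h5 := hbig (w s)
      have h6 : ∑ r ∈ ({s, t} : Finset ℕ), (if w r = w s then (1 : ℤ) else 0) ≤
          ∑ r ∈ Finset.range k, if w r = w s then (1 : ℤ) else 0 := by
        refine Finset.sum_le_sum_of_subset_of_nonneg ?_ ?_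
        · intro r hr
          simp at hr ⊢
          omega
        · intro r _ _
          split_ifs <;> simp
      rw [Finset.sum_pair hst.ne, if_pos rfl, if_pos heq.symm] at h6
      linarith
    have hk3 : 3 ≤ k := by
      by_contra! hk3
      have hk2 : k = 2 := by
        rcases hke with ⟨r, hr⟩
        omega
      subst hk2
      have h4 : (1 : ℤ) ≤ u s(w 0, w 1) := by
        rw [← hTu]
        simp [TU, Finset.sum_range_succ]
      have h5 : (1 : ℤ) ≤ v s(w 0, w 1) := by
        rw [← hTv]
        simp [TU, Finset.sum_range_succ, ← hcl, Sym2.eq_swap]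
      rcases hp.hdisj s(w 0, w 1) with h | h <;> omega
    obtain ⟨y, hy1, hy2, hy3, hy4⟩ := cycle_vec (G := G) w k hk3 hw.1 hcl (by
      intro s hs t ht hst
      rcases lt_trichotomy s t with h | h | h
      · exact absurd hst (hlt s t h ht)
      · exact h
      · exact absurd hst.symm (hlt t s h hs))
    have hle := hn y ⟨?_, ?_, ?_, ?_⟩
    · rw [hy3, hkU] at hle
      have h7 : ((∑ e, u e : ℤ) : ℝ) ≤ n := by
        have : (∑ e, u e : ℤ) ≤ n := by linarith
        exact_mod_cast this
      nlinarith
    · intro e he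
      obtain ⟨t, ht, rfl⟩ := hy1 e he
      exact hw.1 t ht
    · rw [hy2, hke.neg_one_pow]
      simp
    · intro h0
      rw [h0] at hy3
      simp at hy3
      omega
    · intro z hz hz0
      exact hy4 z hz (fun t _ => by rw [hz0]; rfl)

end Combinatorics

section Translation

variable {V : Type*} [Fintype V] [DecidableEq V] {G : SimpleGraph V}

open Classical in
/-- Extension by zero of an exponent vector on edges to all pairs. -/
def extV (a : G.edgeSet →₀ ℕ) : Sym2 V → ℤ :=
  fun e => if h : e ∈ G.edgeSet then (a ⟨e, h⟩ : ℤ) else 0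

/-- Restriction (and truncation) of a vector on pairs to an exponent vector on edges. -/
def resV (G : SimpleGraph V) (x : Sym2 V → ℤ) : G.edgeSet →₀ ℕ :=
  Finsupp.equivFunOnFinite.symm fun e => (x e.1).toNat

lemma extV_coe (a : G.edgeSet →₀ ℕ) (e : G.edgeSet) : extV a e.1 = a e := by
  simp [extV]

lemma extV_of_not_mem (a : G.edgeSet →₀ ℕ) {e : Sym2 V} (he : e ∉ G.edgeSet) : extV a e = 0 := by
  simp [extV, he]

lemma extV_nonneg (a : G.edgeSet →₀ ℕ) : 0 ≤ extV a := by
  intro e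
  unfold extV
  split_ifs <;> simp

lemma extV_mem (a : G.edgeSet →₀ ℕ) (e : Sym2 V) (h : extV a e ≠ 0) : e ∈ G.edgeSet := by
  by_contra hc
  exact h (extV_of_not_mem a hc)

lemma extV_inj {a b : G.edgeSet →₀ ℕ} (h : extV a = extV b) : a = b := by
  ext e
  have := congrFun h e.1
  rw [extV_coe, extV_coe] at this
  exact_mod_cast this

lemma resV_apply (x : Sym2 V → ℤ) (e : G.edgeSet) : resV G x e = (x e.1).toNat := rfl

lemma extV_resV {x : Sym2 V → ℤ} (h0 : 0 ≤ x) (hx : ∀ e, x e ≠ 0 → e ∈ G.edgeSet) :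
    extV (resV G x) = x := by
  funext e
  by_cases he : e ∈ G.edgeSet
  · have := extV_coe (resV G x) ⟨e, he⟩
    simp only [resV_apply] at this
    rw [this]
    exact Int.toNat_of_nonneg (h0 e)
  · rw [extV_of_not_mem _ he]
    by_contra hc
    exact he (hx e (Ne.symm hc))

lemma sum_extV (a : G.edgeSet →₀ ℕ) : ∑ e, extV a e = ((a.sum fun _ k => k : ℕ) : ℤ) := by
  classical
  have : Fintype G.edgeSet := Fintype.ofFinite _
  rw [Finsupp.sum_fintype _ _ (fun _ => rfl), Nat.cast_sum]
  symm
  refine Fintype.sum_of_injective Subtype.val Subtype.val_injective _ _ ?_ ?_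
  · intro e he
    exact extV_of_not_mem a (by simpa using he)
  · intro e
    exact (extV_coe a e).symm

/-- Exponent vector of an edge monomial. -/
def evec (e : Sym2 V) : V →₀ ℕ :=
  Sym2.lift ⟨fun a b => Finsupp.single a 1 + Finsupp.single b 1, fun _ _ => add_comm _ _⟩ e

lemma edgeMono_eq (K : Type*) [Field K] (e : Sym2 V) :
    edgeMono K e = MvPolynomial.monomial (evec e) 1 := by
  induction e with
  | _ a b => simp [edgeMono, evec, MvPolynomial.X, MvPolynomial.monomial_mul]

lemma evec_apply {e : Sym2 V} (he : e ∈ G.edgeSet) (t : V) :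
    evec e t = if t ∈ e then 1 else 0 := by
  induction e with
  | _ a b =>
    have hab : a ≠ b := G.ne_of_adj he
    simp only [evec, Sym2.lift_mk, Finsupp.add_apply, Finsupp.single_apply, Sym2.mem_iff]
    grind

/-- The image exponent of a monomial. -/
def vexp (a : G.edgeSet →₀ ℕ) : V →₀ ℕ := a.sum fun e k => k • evec e.1

lemma vexp_apply (a : G.edgeSet →₀ ℕ) (t : V) : ((vexp a t : ℕ) : ℤ) = dg (extV a) t := by
  classical
  have : Fintype G.edgeSet := Fintype.ofFinite _
  rw [vexp, Finsupp.sum_fintype _ _ (fun _ => by simp), Finsupp.finsetSum_apply, Nat.cast_sum,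
    dg_apply]
  refine Fintype.sum_of_injective Subtype.val Subtype.val_injective _ _ ?_ ?_
  · intro e he
    rw [extV_of_not_mem a (by simpa using he)]
    simp
  · intro e
    rw [extV_coe, Finsupp.smul_apply, evec_apply e.2]
    split_ifs <;> simp

lemma vexp_eq_iff (a b : G.edgeSet →₀ ℕ) : vexp a = vexp b ↔ dg (extV a) = dg (extV b) := by
  constructor
  · intro h
    funext t
    rw [← vexp_apply, ← vexp_apply, h]
  · intro h
    ext t
    have := congrFun h t
    rw [← vexp_apply, ← vexp_apply] at this
    exact_mod_cast this

lemma aeval_mono (K : Type*) [Field K] (a : G.edgeSet →₀ ℕ) (c : K) :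
    MvPolynomial.aeval (R := K) (fun e : G.edgeSet => edgeMono K e.1)
      (MvPolynomial.monomial a c) = MvPolynomial.monomial (vexp a) c := by
  rw [MvPolynomial.aeval_monomial, vexp, Finsupp.sum, Finsupp.prod,
    ← mul_one c, ← MvPolynomial.C_mul_monomial, MvPolynomial.monomial_sum_one]
  simp only [edgeMono_eq, MvPolynomial.monomial_pow, one_pow, mul_one,
    MvPolynomial.algebraMap_eq]

lemma mem_toric (K : Type*) [Field K] (f : MvPolynomial G.edgeSet K) : f ∈ toricIdeal K G ↔
    MvPolynomial.aeval (R := K) (fun e : G.edgeSet => edgeMono K e.1) f = 0 := Iff.rfl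

lemma binom_mem (K : Type*) [Field K] (a b : G.edgeSet →₀ ℕ) :
    binom K a b ∈ toricIdeal K G ↔ dg (extV a) = dg (extV b) := by
  rw [mem_toric, binom, map_sub, aeval_mono, aeval_mono, sub_eq_zero, ← vexp_eq_iff]
  exact (MvPolynomial.monomial_left_injective one_ne_zero).eq_iff

lemma toric_two (K : Type*) [Field K] {f : MvPolynomial G.edgeSet K} (hf : f ≠ 0)
    (hI : f ∈ toricIdeal K G) :
    ∃ a ∈ f.support, ∃ b ∈ f.support, a ≠ b ∧ dg (extV a) = dg (extV b) := by
  by_contra! h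
  obtain ⟨a, ha⟩ := MvPolynomial.support_nonempty.2 hf
  rw [mem_toric, f.as_sum, map_sum] at hI
  simp only [aeval_mono] at hI
  have h1 := congrArg (MvPolynomial.coeff (vexp a)) hI
  rw [MvPolynomial.coeff_sum, Finset.sum_eq_single a] at h1
  · simp at h1
    exact (MvPolynomial.mem_support_iff.1 ha) h1
  · intro b hb hba
    rw [MvPolynomial.coeff_monomial, if_neg]
    rw [vexp_eq_iff]
    exact h b hb a ha hba
  · intro h
    exact absurd ha h

lemma binom_ne_zero (K : Type*) [Field K] {σ : Type*} {a b : σ →₀ ℕ} (h : a ≠ b) :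
    binom K a b ≠ 0 := by
  intro h0
  rw [binom, sub_eq_zero] at h0
  exact h (MvPolynomial.monomial_left_injective one_ne_zero h0)

lemma degreeOf_binom_le (K : Type*) [Field K] {σ : Type*} (a b : σ →₀ ℕ) (e : σ) :
    MvPolynomial.degreeOf e (binom K a b) ≤ max (a e) (b e) := by
  classical
  refine (MvPolynomial.degreeOf_sub_le e _ _).trans ?_
  rw [MvPolynomial.degreeOf_monomial_eq _ _ one_ne_zero,
    MvPolynomial.degreeOf_monomial_eq _ _ one_ne_zero]

lemma circuit_of_minVec (K : Type*) [Field K] {x : Sym2 V → ℤ} (hx : MinVec G x) :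
    IsCircuitBinom K (toricIdeal K G) (resV G x) (resV G (-x)) := by
  obtain ⟨hxe, hxd, hx0, hxm⟩ := hx
  set u := resV G x with hu
  set v := resV G (-x) with hv
  have huv : extV u - extV v = x := by
    funext e
    by_cases he : e ∈ G.edgeSet
    · have h1 := extV_coe u ⟨e, he⟩
      have h2 := extV_coe v ⟨e, he⟩
      simp only [hu, hv, resV_apply, Pi.neg_apply] at h1 h2
      rw [Pi.sub_apply, h1, h2]
      omega
    · rw [Pi.sub_apply, extV_of_not_mem _ he, extV_of_not_mem _ he]
      by_contra hc
      exact he (hxe e (fun h => hc (by rw [h, sub_self])))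
  have hmem : binom K u v ∈ toricIdeal K G := by
    rw [binom_mem, ← sub_eq_zero, ← map_sub, huv, hxd]
  have hne : u ≠ v := by
    intro h
    rw [h, sub_self] at huv
    exact hx0 huv.symm
  -- the main multiplicity property
  have hmult : ∀ a b : G.edgeSet →₀ ℕ, a ≠ b → dg (extV a) = dg (extV b) →
      (∀ e : G.edgeSet, x e.1 = 0 → a e = 0 ∧ b e = 0) →
      ∀ e : G.edgeSet, max (u e) (v e) ≤ max (a e) (b e) := by
    intro a b hab hd hs e
    obtain ⟨k, hk⟩ := hxm (extV a - extV b) (by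
      intro f hf
      by_cases hfG : f ∈ G.edgeSet
      · have h1 := extV_coe a ⟨f, hfG⟩
        have h2 := extV_coe b ⟨f, hfG⟩
        obtain ⟨h3, h4⟩ := hs ⟨f, hfG⟩ hf
        simp only [h3, h4] at h1 h2
        simp [h1, h2]
      · simp [extV_of_not_mem _ hfG]) (by rw [map_sub, hd, sub_self])
    have hk0 : k ≠ 0 := by
      rintro rfl
      rw [zero_smul, sub_eq_zero] at hk
      exact hab (extV_inj hk)
    have hke := congrFun hk e.1
    rw [Pi.sub_apply, extV_coe, extV_coe, Pi.smul_apply, smul_eq_mul] at hke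
    have h1 : u e = (x e.1).toNat := rfl
    have h2 : v e = (-x e.1).toNat := rfl
    have h3 : |x e.1| ≤ |(a e : ℤ) - b e| := by
      rw [hke, abs_mul]
      have : 1 ≤ |k| := Int.one_le_abs hk0
      nlinarith [abs_nonneg (x e.1)]
    clear hke
    rcases abs_cases (x e.1) with h4 | h4 <;>
      rcases abs_cases ((a e : ℤ) - b e) with h5 | h5 <;> omega
  have hsupp : ∀ e : G.edgeSet, x e.1 = 0 ↔ max (u e) (v e) = 0 := by
    intro e
    have h1 : u e = (x e.1).toNat := rfl
    have h2 : v e = (-x e.1).toNat := rfl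
    omega
  refine ⟨hmem, hne, ?_, ?_, ?_⟩
  · rw [Finset.disjoint_left]
    intro e h1 h2
    rw [Finsupp.mem_support_iff] at h1 h2
    have h3 : u e = (x e.1).toNat := rfl
    have h4 : v e = (-x e.1).toNat := rfl
    omega
  · -- irreducibility
    have hb0 := binom_ne_zero K hne
    have key : ∀ f g : MvPolynomial G.edgeSet K, binom K u v = f * g → f ∈ toricIdeal K G →
        IsUnit g := by
      intro f g hfg hf
      have hf0 : f ≠ 0 := by
        rintro rfl
        exact hb0 (by rw [hfg, zero_mul])
      have hg0 : g ≠ 0 := by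
        rintro rfl
        exact hb0 (by rw [hfg, mul_zero])
      have hdeg : ∀ e, MvPolynomial.degreeOf e f + MvPolynomial.degreeOf e g ≤
          max (u e) (v e) := by
        intro e
        rw [← MvPolynomial.degreeOf_mul_eq hf0 hg0, ← hfg]
        exact degreeOf_binom_le K u v e
      obtain ⟨a, ha, b, hb, hab, hd⟩ := toric_two K hf0 hf
      have hle : ∀ c ∈ f.support, ∀ e, c e ≤ MvPolynomial.degreeOf e f := by
        intro c hc e
        exact MvPolynomial.monomial_le_degreeOf e hc
      have hm := hmult a b hab hd (by
        intro e he
        have h1 := (hsupp e).1 he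
        have h2 := hdeg e
        have h3 := hle a ha e
        have h4 := hle b hb e
        omega)
      have hg : ∀ e, MvPolynomial.degreeOf e g = 0 := by
        intro e
        have h1 := hm e
        have h2 := hdeg e
        have h3 := hle a ha e
        have h4 := hle b hb e
        omega
      have hgc : g = MvPolynomial.C (MvPolynomial.coeff 0 g) := by
        apply MvPolynomial.totalDegree_eq_zero_iff_eq_C.1
        rw [MvPolynomial.totalDegree_eq_zero_iff]
        intro m hm e
        have := MvPolynomial.monomial_le_degreeOf e hm
        rw [hg e] at this
        omega
      rw [hgc]
      refine IsUnit.map MvPolynomial.C (isUnit_iff_ne_zero.2 ?_)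
      intro h0
      rw [h0, map_zero] at hgc
      exact hg0 hgc
    constructor
    · intro hunit
      have htop := Ideal.eq_top_of_isUnit_mem _ hmem hunit
      have h1 : (1 : MvPolynomial G.edgeSet K) ∈ toricIdeal K G := by rw [htop]; trivial
      rw [mem_toric, map_one] at h1
      exact one_ne_zero h1
    · intro f g hfg
      have h1 := hmem
      rw [hfg, mem_toric, map_mul, mul_eq_zero] at h1
      rcases h1 with h | h
      · exact Or.inr (key f g hfg h)
      · exact Or.inl (key g f (by rw [hfg, mul_comm]) h)
  · intro a b hab hI hsub
    rw [binom_mem] at hI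
    refine subset_antisymm hsub ?_
    have hm := hmult a b hab hI (by
      intro e he
      have h1 := (hsupp e).1 he
      by_contra hc
      have h2 : e ∈ a.support ∪ b.support := by
        rw [Finset.mem_union, Finsupp.mem_support_iff, Finsupp.mem_support_iff]
        tauto
      have h3 := hsub h2
      rw [Finset.mem_union, Finsupp.mem_support_iff, Finsupp.mem_support_iff] at h3
      omega)
    intro e he
    have h1 := hm e
    rw [Finset.mem_union, Finsupp.mem_support_iff, Finsupp.mem_support_iff] at he ⊢
    omega

lemma primPair_of (K : Type*) [Field K] {u v : G.edgeSet →₀ ℕ}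
    (h : IsPrimitiveBinom K (toricIdeal K G) u v) : PrimPair G (extV u) (extV v) := by
  obtain ⟨hmem, hne, hdis, hprim⟩ := h
  rw [binom_mem] at hmem
  have hd : ∀ e, extV u e = 0 ∨ extV v e = 0 := by
    intro e
    by_cases he : e ∈ G.edgeSet
    · have h1 := extV_coe u ⟨e, he⟩
      have h2 := extV_coe v ⟨e, he⟩
      simp only at h1 h2
      rw [h1, h2]
      by_contra! hc
      have h3 : (⟨e, he⟩ : G.edgeSet) ∈ u.support := by
        rw [Finsupp.mem_support_iff]; exact_mod_cast hc.1
      have h4 : (⟨e, he⟩ : G.edgeSet) ∈ v.support := by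
        rw [Finsupp.mem_support_iff]; exact_mod_cast hc.2
      exact Finset.disjoint_left.1 hdis h3 h4
    · exact Or.inl (extV_of_not_mem u he)
  refine ⟨extV_nonneg u, extV_nonneg v, extV_mem u, extV_mem v, hmem, hd, ?_, ?_⟩
  · intro h0
    have h1 := sum_dg (extV_mem u)
    have h2 := sum_dg (extV_mem v)
    rw [hmem, h2, h0] at h1
    simp at h1
    have h3 : extV v = 0 := by
      rw [Finset.sum_eq_zero_iff_of_nonneg (fun e _ => extV_nonneg v e)] at h1
      funext e
      exact h1 e (Finset.mem_univ e)
    exact hne (extV_inj (h0.trans h3.symm))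
  · intro u' v' hu0 hv0 hu hv hdg hnz
    have hue : ∀ e, u' e ≠ 0 → e ∈ G.edgeSet := by
      intro e he
      refine extV_mem u e fun h => he ?_
      have h1 := hu e
      have h2 := hu0 e
      rw [h] at h1
      exact le_antisymm h1 h2
    have hve : ∀ e, v' e ≠ 0 → e ∈ G.edgeSet := by
      intro e he
      refine extV_mem v e fun h => he ?_
      have h1 := hv e
      have h2 := hv0 e
      rw [h] at h1
      exact le_antisymm h1 h2
    have eu := extV_resV hu0 hue
    have ev := extV_resV hv0 hve
    obtain ⟨h1, h2⟩ := hprim (resV G u') (resV G v') (by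
      intro heq
      have heq' : u' = v' := by rw [← eu, ← ev, heq]
      have hz : u' = 0 := by
        funext e
        have a1 := hu e
        have a2 := hu0 e
        have a3 := hv e
        rw [← heq'] at a3
        rcases hd e with h | h
        · rw [h] at a1; exact le_antisymm a1 a2
        · rw [h] at a3; exact le_antisymm a3 a2
      rcases hnz with h | h
      · exact h hz
      · exact h (heq' ▸ hz)) (by rw [binom_mem, eu, ev, hdg]) (by
      intro e
      have : u' e.1 ≤ extV u e.1 := hu e.1
      rw [extV_coe] at this
      rw [resV_apply]
      omega) (by
      intro e
      have : v' e.1 ≤ extV v e.1 := hv e.1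
      rw [extV_coe] at this
      rw [resV_apply]
      omega)
    exact ⟨by rw [← eu, h1], by rw [← ev, h2]⟩

end Translation

/-- If every circuit of the toric ideal of a finite graph `G` has degree at most `n`, then
every primitive binomial (every Graver basis element) of the toric ideal has degree at
most `n² · e^(2n/e)`. -/
theorem stmt15 {V : Type*} [Fintype V] [DecidableEq V] (K : Type*) [Field K]
    (G : SimpleGraph V) (n : ℕ)
    (hcirc : ∀ u v : G.edgeSet →₀ ℕ, IsCircuitBinom K (toricIdeal K G) u v →
      (binom K u v).totalDegree ≤ n) :
    ∀ u v : G.edgeSet →₀ ℕ, IsPrimitiveBinom K (toricIdeal K G) u v →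
      ((binom K u v).totalDegree : ℝ)
        ≤ (n : ℝ) ^ 2 * Real.exp (2 * n / Real.exp 1) := by
  intro u v huv
  have hp := primPair_of K huv
  have hmain := comb_main hp n (by
    intro x hx
    have hdeg := hcirc _ _ (circuit_of_minVec K hx)
    have hpos : ∀ e, |x e| = 2 * extV (resV G x) e - x e := by
      intro e
      by_cases he : e ∈ G.edgeSet
      · have h1 := extV_coe (resV G x) ⟨e, he⟩
        simp only [resV_apply] at h1
        rw [h1]
        rcases abs_cases (x e) with h | h <;> omega
      · rw [extV_of_not_mem _ he]
        have : x e = 0 := by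
          by_contra hc
          exact he (hx.1 e hc)
        simp [this]
    have hs0 : ∑ e, x e = 0 := by
      have h1 := sum_dg hx.1
      rw [hx.2.1] at h1
      simpa using h1.symm
    have hne : resV G x ≠ resV G (-x) := (circuit_of_minVec K hx).2.1
    have hsup : resV G x ∈ (binom K (resV G x) (resV G (-x))).support := by
      classical
      rw [MvPolynomial.mem_support_iff, binom, MvPolynomial.coeff_sub, MvPolynomial.coeff_monomial,
        MvPolynomial.coeff_monomial, if_pos rfl, if_neg hne.symm]
      simp
    have hle := MvPolynomial.le_totalDegree hsup
    have hle2 : ((resV G x).sum fun _ k => k) ≤ n := hle.trans hdeg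
    simp only [hpos, Finset.sum_sub_distrib, ← Finset.mul_sum, hs0, sum_extV]
    have : (((resV G x).sum fun _ k => k : ℕ) : ℤ) ≤ n := by exact_mod_cast hle2
    linarith)
  refine le_trans ?_ hmain
  have hsum : ∑ e, extV u e = ∑ e, extV v e := by
    have h1 := sum_dg hp.hue
    have h2 := sum_dg hp.hve
    rw [hp.hdeg] at h1
    linarith
  have hle : (binom K u v).totalDegree ≤ u.sum fun _ k => k := by
    have hvu : (v.sum fun _ k => k) = u.sum fun _ k => k := by
      rw [sum_extV, sum_extV] at hsum
      exact_mod_cast hsum.symm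
    refine (MvPolynomial.totalDegree_sub _ _).trans ?_
    rw [MvPolynomial.totalDegree_monomial _ one_ne_zero,
      MvPolynomial.totalDegree_monomial _ one_ne_zero]
    exact max_le le_rfl hvu.le
  rw [sum_extV]
  exact_mod_cast hle
end
end
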